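/- arXiv:math/9404210 — 2 statements merged into one kernel-verified Lean document; each statement's English description precedes it below -/
import Mathlib

section
/- Let A be a unital complex C*-algebra and u₁, …, uₙ ∈ A a spin system (u_i* = u_i, u_i² = 1 for all i, and u_i u_j + u_j u_i = 0 for i ≠ j). Then for every α ∈ ℂⁿ the element x = ∑_{j=1}^n α_j u_j satisfies ‖α‖₂ ≤ ‖x‖ ≤ √2 · ‖α‖₂, where ‖α‖₂ = (∑ |α_j|²)^{1/2}. In particular the linear span of a spin system is √2-isomorphic to a Hilbert space. -/
open scoped BigOperators

section SpinSystem

variable {A : Type*} [NormedRing A] [StarRing A] [NormedAlgebra ℂ A] [StarModule ℂ A]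
  {n : ℕ} {u : Fin n → A}

theorem spin_star_sum_smul (hsa : ∀ i, star (u i) = u i) (α : Fin n → ℂ) :
    star (∑ j, α j • u j) = ∑ j, star (α j) • u j := by
  simp [star_sum, hsa]

theorem spin_star_mul_self_add_self_mul_star
    (hsa : ∀ i, star (u i) = u i) (hsq : ∀ i, u i * u i = 1)
    (hanti : ∀ i j, i ≠ j → u i * u j + u j * u i = 0) (α : Fin n → ℂ) :
    star (∑ j, α j • u j) * (∑ j, α j • u j) + (∑ j, α j • u j) * star (∑ j, α j • u j) =
      (2 * (∑ j, ‖α j‖ ^ 2 : ℝ) : ℂ) • (1 : A) := by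
  have hcross : (∑ j, α j • u j) * (∑ j, star (α j) • u j) =
      ∑ i, ∑ j, (star (α i) * α j) • (u j * u i) := by
    rw [Finset.sum_mul_sum, Finset.sum_comm]
    simp only [smul_mul_smul_comm, mul_comm]
  rw [spin_star_sum_smul hsa, hcross, Finset.sum_mul_sum, ← Finset.sum_add_distrib]
  push_cast
  rw [Finset.mul_sum, Finset.sum_smul]
  refine Finset.sum_congr rfl fun i _ => ?_
  rw [← Finset.sum_add_distrib, Finset.sum_eq_single i]
  · rw [smul_mul_smul_comm, hsq, ← add_smul, ← two_mul]
    congr 2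
    exact Complex.conj_mul' (α i)
  · intro j _ hj
    rw [smul_mul_smul_comm, ← smul_add, hanti i j hj.symm, smul_zero]
  · simp

variable [CStarRing A] [Nontrivial A]

theorem spin_norm_star_mul_self_add_self_mul_star
    (hsa : ∀ i, star (u i) = u i) (hsq : ∀ i, u i * u i = 1)
    (hanti : ∀ i j, i ≠ j → u i * u j + u j * u i = 0) (α : Fin n → ℂ) :
    ‖star (∑ j, α j • u j) * (∑ j, α j • u j) + (∑ j, α j • u j) * star (∑ j, α j • u j)‖ =
      2 * ∑ j, ‖α j‖ ^ 2 := by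
  rw [spin_star_mul_self_add_self_mul_star hsa hsq hanti, norm_smul, CStarRing.norm_one, mul_one,
    norm_mul, Complex.norm_real, Real.norm_of_nonneg (by positivity)]
  simp

theorem sqrt_sum_le_norm_spin_sum
    (hsa : ∀ i, star (u i) = u i) (hsq : ∀ i, u i * u i = 1)
    (hanti : ∀ i j, i ≠ j → u i * u j + u j * u i = 0) (α : Fin n → ℂ) :
    √(∑ j, ‖α j‖ ^ 2) ≤ ‖∑ j, α j • u j‖ := by
  apply Real.sqrt_le_iff.mpr ⟨norm_nonneg _, ?_⟩
  have h := spin_norm_star_mul_self_add_self_mul_star hsa hsq hanti α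
  have h' := norm_add_le (star (∑ j, α j • u j) * (∑ j, α j • u j))
    ((∑ j, α j • u j) * star (∑ j, α j • u j))
  rw [CStarRing.norm_star_mul_self, CStarRing.norm_self_mul_star] at h'
  linarith

theorem norm_sq_spin_sum_real
    (hsa : ∀ i, star (u i) = u i) (hsq : ∀ i, u i * u i = 1)
    (hanti : ∀ i j, i ≠ j → u i * u j + u j * u i = 0) (β : Fin n → ℝ) :
    ‖∑ j, (β j : ℂ) • u j‖ ^ 2 = ∑ j, β j ^ 2 := by
  have h := spin_norm_star_mul_self_add_self_mul_star hsa hsq hanti fun j => (β j : ℂ)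
  have hstar : star (∑ j, (β j : ℂ) • u j) = ∑ j, (β j : ℂ) • u j := by
    simp [hsa]
  have hnorm := CStarRing.norm_star_mul_self (x := ∑ j, (β j : ℂ) • u j)
  rw [hstar] at h hnorm
  rw [← two_smul ℂ, norm_smul, hnorm] at h
  simp only [Complex.norm_real, Real.norm_eq_abs, sq_abs, Complex.norm_ofNat] at h
  linarith

theorem norm_spin_sum_le
    (hsa : ∀ i, star (u i) = u i) (hsq : ∀ i, u i * u i = 1)
    (hanti : ∀ i j, i ≠ j → u i * u j + u j * u i = 0) (α : Fin n → ℂ) :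
    ‖∑ j, α j • u j‖ ≤ √2 * √(∑ j, ‖α j‖ ^ 2) := by
  have hdecomp : ∑ j, α j • u j =
      ∑ j, ((α j).re : ℂ) • u j + Complex.I • ∑ j, ((α j).im : ℂ) • u j := by
    rw [Finset.smul_sum, ← Finset.sum_add_distrib]
    refine Finset.sum_congr rfl fun j _ => ?_
    rw [smul_smul, ← add_smul, mul_comm Complex.I, Complex.re_add_im]
  have hsum : ∑ j, ‖α j‖ ^ 2 = ∑ j, (α j).re ^ 2 + ∑ j, (α j).im ^ 2 := by
    rw [← Finset.sum_add_distrib]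
    refine Finset.sum_congr rfl fun j _ => ?_
    rw [Complex.sq_norm, Complex.normSq_apply, sq, sq]
  rw [← Real.sqrt_mul zero_le_two, hsum, ← norm_sq_spin_sum_real hsa hsq hanti,
    ← norm_sq_spin_sum_real hsa hsq hanti, hdecomp]
  refine (norm_add_le _ _).trans (Real.le_sqrt_of_sq_le ?_)
  rw [norm_smul, Complex.norm_I, one_mul]
  exact add_sq_le

end SpinSystem

theorem spin_system_span_hilbertian
    (A : Type) [NormedRing A] [StarRing A] [CStarRing A]
    [NormedAlgebra ℂ A] [CompleteSpace A] [StarModule ℂ A] [Nontrivial A]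
    (n : ℕ) (u : Fin n → A)
    (hsa : ∀ i, star (u i) = u i) (hsq : ∀ i, u i * u i = 1)
    (hanti : ∀ i j, i ≠ j → u i * u j + u j * u i = 0)
    (α : Fin n → ℂ) :
    Real.sqrt (∑ j, ‖α j‖ ^ 2) ≤ ‖∑ j, α j • u j‖ ∧
      ‖∑ j, α j • u j‖ ≤ Real.sqrt 2 * Real.sqrt (∑ j, ‖α j‖ ^ 2) := by
  exact ⟨sqrt_sum_le_norm_spin_sum hsa hsq hanti α, norm_spin_sum_le hsa hsq hanti α⟩
end

section
/- Let K be a compact Hausdorff space, F a complex Banach space, 2 < r < ∞, and T : C(K) → F a bounded linear operator such that for some constant C > 0, for every n ∈ ℕ and all x₁, …, xₙ ∈ C(K) one has ∑_{k=1}^n ‖T x_k‖ ≤ C · n^{1−1/r} · sup_{t∈K} ∑_{k=1}^n |x_k(t)|. Let 2 < q < r be defined by 2/q = 1/2 + 1/r. Then for every n and all x₁, …, xₙ ∈ C(K): (∑_{k=1}^n ‖T x_k‖^q)^{1/q} ≤ C · (1/q − 1/r)^{−1/q} · n^{1/q − 1/r} · sup_{t∈K} ∑_{k=1}^n |x_k(t)|.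 -/
open scoped BigOperators

/-- Integral-comparison step for sums of `k ^ (p - 1)`. -/
lemma rpow_div_add_rpow_sub_one_le (m : ℕ) {p : ℝ} (hp : 0 < p) (hp1 : p ≤ 1) :
    (m : ℝ) ^ p / p + ((m : ℝ) + 1) ^ (p - 1) ≤ ((m : ℝ) + 1) ^ p / p := by
  have hM : (0 : ℝ) < (m : ℝ) + 1 := by positivity
  have hinv : ((m : ℝ) + 1)⁻¹ ≤ 1 := inv_le_one_of_one_le₀ (by linarith [Nat.cast_nonneg (α := ℝ) m])
  have bern : (1 + -((m : ℝ) + 1)⁻¹) ^ p ≤ 1 + p * -((m : ℝ) + 1)⁻¹ :=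
    rpow_one_add_le_one_add_mul_self (by linarith) hp.le hp1
  have hm : (m : ℝ) = ((m : ℝ) + 1) * (1 + -((m : ℝ) + 1)⁻¹) := by field_simp; ring
  have h1 : (m : ℝ) ^ p = ((m : ℝ) + 1) ^ p * (1 + -((m : ℝ) + 1)⁻¹) ^ p := by
    conv_lhs => rw [hm]
    exact Real.mul_rpow hM.le (by linarith)
  have h2 : (m : ℝ) ^ p ≤ ((m : ℝ) + 1) ^ p * (1 + p * -((m : ℝ) + 1)⁻¹) := by
    rw [h1]; gcongr
  rw [Real.rpow_sub_one hM.ne', div_add' _ _ _ hp.ne']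
  gcongr
  calc _ ≤ ((m : ℝ) + 1) ^ p * (1 + p * -((m : ℝ) + 1)⁻¹) + ((m : ℝ) + 1) ^ p / ((m : ℝ) + 1) * p := by
        gcongr
    _ = _ := by field_simp; ring

/-- A weak-type bound on all partial sums of a nonnegative family bounds its `q`-th power sums. -/
lemma sum_rpow_le_of_sum_le_card_rpow {ι : Type*} [DecidableEq ι] (a : ι → ℝ) (ha : ∀ i, 0 ≤ a i)
    {B q r : ℝ} (hB : 0 ≤ B) (hq : 0 < q) (hqr : q < r)
    (h : ∀ s : Finset ι, ∑ i ∈ s, a i ≤ B * (s.card : ℝ) ^ (1 - 1 / r)) (s : Finset ι) :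
    ∑ i ∈ s, a i ^ q ≤ B ^ q * ((s.card : ℝ) ^ (1 - q / r) / (1 - q / r)) := by
  have hr : 0 < r := hq.trans hqr
  have hp : 0 < 1 - q / r := by
    rw [sub_pos, div_lt_one hr]; exact hqr
  have hp1 : 1 - q / r ≤ 1 := by
    linarith [div_pos hq hr]
  induction hm : s.card generalizing s with
  | zero =>
    obtain rfl := Finset.card_eq_zero.mp hm
    simp [Real.zero_rpow hp.ne']
  | succ m ih =>
    have hne : s.Nonempty := Finset.card_pos.mp (by omega)
    obtain ⟨i, hi, hmin⟩ := s.exists_min_image a hne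
    have hM : (0 : ℝ) < (m : ℝ) + 1 := by positivity
    have hai : a i ≤ B * ((m : ℝ) + 1) ^ (-(1 / r)) := by
      have h1 : s.card • a i ≤ ∑ j ∈ s, a j := s.card_nsmul_le_sum a (a i) hmin
      have h2 := h1.trans (h s)
      rw [hm, nsmul_eq_mul, Nat.cast_add_one, sub_eq_add_neg, Real.rpow_add hM,
        Real.rpow_one] at h2
      refine le_of_mul_le_mul_left (h2.trans_eq ?_) hM
      ring
    have haq : a i ^ q ≤ B ^ q * ((m : ℝ) + 1) ^ (1 - q / r - 1) := by
      calc a i ^ q ≤ (B * ((m : ℝ) + 1) ^ (-(1 / r))) ^ q :=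
            Real.rpow_le_rpow (ha i) hai hq.le
        _ = _ := by
            rw [Real.mul_rpow hB (by positivity), ← Real.rpow_mul hM.le]
            congr 2
            ring
    have he := ih (s.erase i) (by rw [Finset.card_erase_of_mem hi, hm]; rfl)
    rw [← Finset.sum_erase_add s _ hi, Nat.cast_add_one]
    calc _ ≤ B ^ q * ((m : ℝ) ^ (1 - q / r) / (1 - q / r)) +
            B ^ q * ((m : ℝ) + 1) ^ (1 - q / r - 1) := add_le_add he haq
      _ = B ^ q * ((m : ℝ) ^ (1 - q / r) / (1 - q / r) + ((m : ℝ) + 1) ^ (1 - q / r - 1)) := by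
          ring
      _ ≤ _ := by
          gcongr
          exact rpow_div_add_rpow_sub_one_le m hp hp1

theorem q_one_summing_estimate_for_limit_order_summing
    (K : Type) [TopologicalSpace K] [CompactSpace K] [T2Space K]
    (F : Type) [NormedAddCommGroup F] [NormedSpace ℂ F]
    (r : ℝ) (hr : 2 < r)
    (T : C(K, ℂ) →L[ℂ] F) (C : ℝ) (hC : 0 < C)
    (hT : ∀ (n : ℕ) (x : Fin n → C(K, ℂ)),
        ∑ k, ‖T (x k)‖ ≤ C * (n : ℝ) ^ (1 - 1/r) * ⨆ t : K, ∑ k, ‖x k t‖)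
    (q : ℝ) (hq : 2/q = 1/2 + 1/r) :
    ∀ (n : ℕ) (x : Fin n → C(K, ℂ)),
      (∑ k, ‖T (x k)‖ ^ q) ^ (1/q) ≤
        C * (1/q - 1/r) ^ (-(1/q)) * (n : ℝ) ^ (1/q - 1/r) *
          ⨆ t : K, ∑ k, ‖x k t‖ := by
  intro n x
  have hr0 : 0 < r := by linarith
  have hri : 0 < 1 / r := by positivity
  have hri2 : 1 / r < 1 / 2 := one_div_lt_one_div_of_lt (by norm_num) hr
  have hqi : 1 / q = (1 / 2 + 1 / r) / 2 := by rw [← hq]; ring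
  have hqpos : 0 < q := one_div_pos.mp (by rw [hqi]; positivity)
  have hqr : q < r := (one_div_lt_one_div hr0 hqpos).mp (by linarith)
  have hq1 : 1 ≤ q := (one_div_le_one_div hqpos one_pos).mp (by rw [hqi]; linarith)
  have hδ : 0 < 1 / q - 1 / r := by linarith
  have hp : 1 - q / r = q * (1 / q - 1 / r) := by field_simp
  set S : ℝ := ⨆ t : K, ∑ k, ‖x k t‖ with hS
  have hS0 : 0 ≤ S := Real.iSup_nonneg fun t => Finset.sum_nonneg fun k _ => norm_nonneg _
  have hbdd : BddAbove (Set.range fun t : K => ∑ k, ‖x k t‖) :=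
    (isCompact_range (by fun_prop)).bddAbove
  have hsub (s : Finset (Fin n)) :
      ∑ i ∈ s, ‖T (x i)‖ ≤ C * S * (s.card : ℝ) ^ (1 - 1 / r) := by
    have key (f : Fin n → ℝ) : ∑ k, f (s.equivFin.symm k) = ∑ i ∈ s, f i := by
      rw [s.equivFin.symm.sum_comp fun i : s => f i, Finset.sum_coe_sort s f]
    have h1 := hT s.card fun k => x (s.equivFin.symm k)
    rw [key fun i => ‖T (x i)‖] at h1
    have h2 : ⨆ t : K, ∑ k, ‖x (s.equivFin.symm k) t‖ ≤ S := by
      refine Real.iSup_le (fun t => ?_) hS0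
      rw [key fun i => ‖x i t‖]
      exact (Finset.sum_le_univ_sum_of_nonneg fun i => norm_nonneg _).trans (le_ciSup hbdd t)
    calc _ ≤ _ := h1
      _ ≤ C * (s.card : ℝ) ^ (1 - 1 / r) * S := by gcongr
      _ = _ := by ring
  have hsum := sum_rpow_le_of_sum_le_card_rpow (fun i => ‖T (x i)‖) (fun i => norm_nonneg _)
    (mul_nonneg hC.le hS0) hqpos hqr hsub Finset.univ
  rw [Finset.card_univ, Fintype.card_fin, hp] at hsum
  have hsum' : ∑ k, ‖T (x k)‖ ^ q ≤
      (C * S) ^ q * ((n : ℝ) ^ (q * (1 / q - 1 / r)) * (1 / q - 1 / r)⁻¹) := by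
    refine hsum.trans ?_
    rw [div_eq_mul_inv]
    gcongr
    exact le_mul_of_one_le_left hδ.le hq1
  calc _ ≤ ((C * S) ^ q * ((n : ℝ) ^ (q * (1 / q - 1 / r)) * (1 / q - 1 / r)⁻¹)) ^ (1 / q) :=
        Real.rpow_le_rpow (by positivity) hsum' (by positivity)
    _ = _ := by
        have hqq : q * (1 / q) = 1 := mul_one_div_cancel hqpos.ne'
        rw [Real.mul_rpow (x := (C * S) ^ q) (by positivity) (by positivity),
          Real.mul_rpow (x := (n : ℝ) ^ _) (by positivity) (by positivity),
          ← Real.rpow_mul (by positivity), hqq,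
          Real.rpow_one, ← Real.rpow_mul (by positivity), mul_right_comm q, hqq, one_mul,
          Real.inv_rpow hδ.le, ← Real.rpow_neg hδ.le]
        ring
end
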